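/- arXiv:1211.3511 — 13 statements merged into one kernel-verified Lean document; each statement's English description precedes it below -/
import Mathlib

section
/- Let Δ : M₂(ℂ) → M₂(ℂ)⊗M₂(ℂ) be a quantum quadratic operator for which the normalized trace τ is a Haar state. Then there exist real vectors b_{ml} = (b_{ml,1}, b_{ml,2}, b_{ml,3}) ∈ ℝ³ (m,l ∈ {1,2,3}) such that for every x = w₀·1 + w·σ ∈ M₂(ℂ) one has Δ(x) = w₀·(1⊗1) + Σ_{m,l=1}^{3} (Σ_{k=1}^{3} b_{ml,k} w_k) σ_m⊗σ_l. -/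
open Matrix Complex Kronecker ComplexOrder

/-- `M₂(ℂ)`. -/
abbrev M2 : Type := Matrix (Fin 2) (Fin 2) ℂ

/-- `M₂(ℂ) ⊗ M₂(ℂ)` identified with `M₄(ℂ)` via the Kronecker product. -/
abbrev M4 : Type := Matrix (Fin 2 × Fin 2) (Fin 2 × Fin 2) ℂ

/-- The Pauli matrices `σ₁, σ₂, σ₃`. -/
noncomputable def Pauli : Fin 3 → M2 :=
  ![!![0, 1; 1, 0], !![0, -Complex.I; Complex.I, 0], !![1, 0; 0, -1]]

/-- A quantum quadratic operator: unital and positive. -/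
def IsQQO (Δ : M2 →ₗ[ℂ] M4) : Prop :=
  Δ 1 = 1 ∧ ∀ x : M2, x.PosSemidef → (Δ x).PosSemidef

/-- The normalized trace `τ` is a Haar state for `Δ`:
`(τ ⊗ id)(Δ x) = (id ⊗ τ)(Δ x) = τ(x)·1`. -/
def HaarTau (Δ : M2 →ₗ[ℂ] M4) : Prop :=
  ∀ x : M2,
    (Matrix.of fun i j : Fin 2 => (1 / 2 : ℂ) * ∑ k : Fin 2, Δ x (k, i) (k, j))
      = (Matrix.trace x / 2) • (1 : M2) ∧
    (Matrix.of fun i j : Fin 2 => (1 / 2 : ℂ) * ∑ k : Fin 2, Δ x (i, k) (j, k))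
      = (Matrix.trace x / 2) • (1 : M2)

lemma pauli_herm (k : Fin 3) : (Pauli k)ᴴ = Pauli k := by
  fin_cases k <;> ext i j <;> fin_cases i <;> fin_cases j <;> simp [Pauli]

lemma pauli_sq (k : Fin 3) : Pauli k * Pauli k = 1 := by
  fin_cases k <;> ext i j <;> fin_cases i <;> fin_cases j <;> simp [Pauli, Matrix.mul_apply]

lemma pauli_trace (k : Fin 3) : (Pauli k).trace = 0 := by
  fin_cases k <;> simp [Pauli, Matrix.trace]

lemma delta_pauli_herm (Δ : M2 →ₗ[ℂ] M4) (h : IsQQO Δ) (k : Fin 3) :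
    (Δ (Pauli k))ᴴ = Δ (Pauli k) := by
  have h1 : ((1 + Pauli k)ᴴ * (1 + Pauli k)) = (2 : ℂ) • (1 + Pauli k) := by
    rw [conjTranspose_add, pauli_herm, conjTranspose_one, add_mul, mul_add, mul_add, pauli_sq]
    simp only [one_mul, mul_one, two_smul]
    abel
  have h2 := (h.2 _ (posSemidef_conjTranspose_mul_self (1 + Pauli k))).isHermitian
  rw [h1, map_smul, map_add, h.1, Matrix.IsHermitian, conjTranspose_smul, conjTranspose_add,
    conjTranspose_one] at h2
  simp only [star_ofNat] at h2
  exact add_left_cancel (smul_right_injective _ (two_ne_zero : (2 : ℂ) ≠ 0) h2)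

set_option maxHeartbeats 4000000 in
lemma expand (Y : M4) (hY : Yᴴ = Y)
    (h1 : ∀ i j, ∑ k : Fin 2, Y (k, i) (k, j) = 0)
    (h2 : ∀ i j, ∑ k : Fin 2, Y (i, k) (j, k) = 0) :
    ∃ c : Fin 3 → Fin 3 → ℝ, Y = ∑ m, ∑ l, (c m l : ℂ) • (Pauli m ⊗ₖ Pauli l) := by
  refine ⟨fun m l => (Matrix.trace (Y * (Pauli m ⊗ₖ Pauli l))).re / 4, ?_⟩
  have hs : ∀ p q, star (Y q p) = Y p q := fun p q => congrFun (congrFun hY p) q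
  have hr : ∀ p q, (Y q p).re = (Y p q).re := fun p q => by rw [← hs p q]; simp
  have hi : ∀ p q, -(Y q p).im = (Y p q).im := fun p q => by rw [← hs p q]; simp
  have e1r := fun i j => congrArg Complex.re (h1 i j)
  have e1i := fun i j => congrArg Complex.im (h1 i j)
  have e2r := fun i j => congrArg Complex.re (h2 i j)
  have e2i := fun i j => congrArg Complex.im (h2 i j)
  simp only [Fin.forall_fin_two, Fin.sum_univ_two, Complex.add_re, Complex.add_im,
    Complex.zero_re, Complex.zero_im, Prod.forall] at hr hi e1r e1i e2r e2i
  ext ⟨i, j⟩ ⟨i', j'⟩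
  fin_cases i <;> fin_cases j <;> fin_cases i' <;> fin_cases j' <;>
  apply Complex.ext <;>
  simp [Fin.sum_univ_three, Pauli, Matrix.trace, Matrix.mul_apply, Fintype.sum_prod_type,
    Matrix.add_apply, Matrix.smul_apply, kroneckerMap_apply] <;>
  linarith

/-- If `Δ` is a q.q.o. with Haar state `τ`, then there are real vectors
`b_{ml} ∈ ℝ³` such that
`Δ(w₀·1 + w·σ) = w₀·(1⊗1) + ∑_{m,l} (∑_k b_{ml,k} w_k) σ_m ⊗ σ_l`. -/
theorem qqo_canonical_form (Δ : M2 →ₗ[ℂ] M4) (hQQO : IsQQO Δ) (hHaar : HaarTau Δ) :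
    ∃ b : Fin 3 → Fin 3 → Fin 3 → ℝ,
      ∀ (w₀ : ℂ) (w : Fin 3 → ℂ),
        Δ (w₀ • (1 : M2) + ∑ k, w k • Pauli k)
          = w₀ • (1 : M4)
            + ∑ m, ∑ l, (∑ k, (b m l k : ℂ) * w k) • (Pauli m ⊗ₖ Pauli l) := by
  have hex : ∀ k, ∃ c : Fin 3 → Fin 3 → ℝ,
      Δ (Pauli k) = ∑ m, ∑ l, (c m l : ℂ) • (Pauli m ⊗ₖ Pauli l) := by
    intro k
    obtain ⟨ha, hb⟩ := hHaar (Pauli k)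
    rw [pauli_trace, zero_div, zero_smul] at ha hb
    refine expand _ (delta_pauli_herm Δ hQQO k) (fun i j => ?_) (fun i j => ?_)
    · have := congrFun (congrFun ha i) j
      simpa only [Matrix.of_apply, Matrix.zero_apply, mul_eq_zero, one_div, inv_eq_zero,
        OfNat.ofNat_ne_zero, false_or] using this
    · have := congrFun (congrFun hb i) j
      simpa only [Matrix.of_apply, Matrix.zero_apply, mul_eq_zero, one_div, inv_eq_zero,
        OfNat.ofNat_ne_zero, false_or] using this
  choose c hc using hex
  refine ⟨fun m l k => c k m l, fun w₀ w => ?_⟩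
  rw [map_add, map_smul, hQQO.1, map_sum]
  congr 1
  simp only [map_smul, hc, Finset.smul_sum, Finset.sum_smul, smul_smul]
  rw [Finset.sum_comm]
  refine Finset.sum_congr rfl fun m _ => ?_
  rw [Finset.sum_comm]
  refine Finset.sum_congr rfl fun l _ => Finset.sum_congr rfl fun k _ => ?_
  rw [mul_comm]
end

section
/- Let Δ : M₂(ℂ) → M₂(ℂ)⊗M₂(ℂ) be a quantum quadratic operator for which the normalized trace τ is a Haar state, with real coefficients b_{ml,k} as in its canonical representation Δ(w₀·1 + w·σ) = w₀·(1⊗1) + Σ_{m,l} (Σ_k b_{ml,k} w_k) σ_m⊗σ_l. For f ∈ ℝ³ define the 3×3 matrix 𝔹(f) by 𝔹(f)_{ij} = Σ_{k=1}^{3} b_{ki,j} f_k. Then for every f in the closed unit ball S = {f ∈ ℝ³ : ‖f‖ ≤ 1}, the operator norm of 𝔹(f) (as an operator on ℂ³ with the Euclidean norm) is at most 1. -/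
open Matrix Complex Kronecker ComplexOrder

noncomputable def Pst (f : Fin 3 → ℝ) : M2 := (1 : ℂ) • (1 : M2) + ∑ k, (f k : ℂ) • Pauli k

lemma Pst_eq (f : Fin 3 → ℝ) :
    Pst f = !![1 + (f 2 : ℂ), f 0 - f 1 * Complex.I; f 0 + f 1 * Complex.I, 1 - f 2] := by
  ext i j
  fin_cases i <;> fin_cases j <;> simp [Pst, Pauli, Fin.sum_univ_three] <;> ring

lemma Pst_psd (f : Fin 3 → ℝ) (hf : f 0 ^ 2 + f 1 ^ 2 + f 2 ^ 2 ≤ 1) : (Pst f).PosSemidef := by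
  have hH : (Pst f)ᴴ = Pst f := by
    rw [Pst_eq]
    ext i j
    fin_cases i <;> fin_cases j <;> simp [Matrix.conjTranspose_apply] <;> ring
  have h : Pst f = (1/2 : ℝ) • ((Pst f)ᴴ * Pst f +
      (1 - (f 0 ^ 2 + f 1 ^ 2 + f 2 ^ 2) : ℝ) • (1 : M2)) := by
    rw [hH, Pst_eq]
    have := Complex.I_sq
    ext i j
    fin_cases i <;> fin_cases j <;> simp [Matrix.mul_apply, Fin.sum_univ_two] <;>
      ring_nf <;> (try simp [Complex.I_sq]) <;> ring
  rw [h]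
  refine Matrix.PosSemidef.smul ?_ (by norm_num)
  refine (Matrix.posSemidef_conjTranspose_mul_self _).add ?_
  exact Matrix.PosSemidef.one.smul (by linarith)

lemma trace_psd {n : Type*} [Fintype n] [DecidableEq n] (A B : Matrix n n ℂ)
    (hA : A.PosSemidef) (hB : B.PosSemidef) : 0 ≤ (A * B).trace := by
  obtain ⟨C, rfl⟩ := (by open scoped MatrixOrder in
    exact CStarAlgebra.nonneg_iff_eq_star_mul_self.mp hA.nonneg : ∃ C, A = Cᴴ * C)
  rw [Matrix.mul_assoc, Matrix.trace_mul_comm]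
  exact (hB.mul_mul_conjTranspose_same C).trace_nonneg

lemma trace_pst (f : Fin 3 → ℝ) (m : Fin 3) : (Pst f * Pauli m).trace = 2 * f m := by
  rw [Pst_eq]
  fin_cases m <;> simp [Pauli, Matrix.trace, Matrix.mul_apply, Fin.sum_univ_two] <;> ring_nf <;>
    (try simp [Complex.I_sq])

lemma trace_pst1 (f : Fin 3 → ℝ) : (Pst f).trace = 2 := by
  rw [Pst_eq]
  simp [Matrix.trace, Fin.sum_univ_two]; ring

lemma key (Δ : M2 →ₗ[ℂ] M4) (hQQO : IsQQO Δ)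
    (b : Fin 3 → Fin 3 → Fin 3 → ℝ)
    (hb : ∀ (w₀ : ℂ) (w : Fin 3 → ℂ),
        Δ (w₀ • (1 : M2) + ∑ k, w k • Pauli k)
          = w₀ • (1 : M4)
            + ∑ m, ∑ l, (∑ k, (b m l k : ℂ) * w k) • (Pauli m ⊗ₖ Pauli l))
    (f g w : Fin 3 → ℝ) (hf : f 0 ^ 2 + f 1 ^ 2 + f 2 ^ 2 ≤ 1)
    (hg : g 0 ^ 2 + g 1 ^ 2 + g 2 ^ 2 ≤ 1) (hw : w 0 ^ 2 + w 1 ^ 2 + w 2 ^ 2 ≤ 1) :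
    0 ≤ 1 + ∑ m, ∑ l, (∑ k, b m l k * w k) * (f m * g l) := by
  have h1 := hQQO.2 _ (Pst_psd w hw)
  have h2 := trace_psd _ _ ((Pst_psd f hf).kronecker (Pst_psd g hg)) h1
  have h3 : ((Pst f ⊗ₖ Pst g) * Δ (Pst w)).trace =
      ((4 * (1 + ∑ m, ∑ l, (∑ k, b m l k * w k) * (f m * g l)) : ℝ) : ℂ) := by
    rw [show Δ (Pst w) = _ from hb 1 (fun k => (w k : ℂ))]
    simp only [Matrix.mul_add, Matrix.mul_sum, Matrix.mul_smul, Matrix.trace_add,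
      Matrix.trace_sum, Matrix.trace_smul, ← Matrix.mul_kronecker_mul, Matrix.trace_kronecker,
      trace_pst, trace_pst1, Matrix.mul_one]
    push_cast
    simp only [smul_eq_mul, mul_add, Finset.mul_sum]
    congr 1
    · norm_num
    · refine Finset.sum_congr rfl fun m _ => Finset.sum_congr rfl fun l _ => ?_
      rw [Finset.sum_mul, Finset.sum_mul, Finset.mul_sum]
      refine Finset.sum_congr rfl fun k _ => ?_
      ring
  rw [h3] at h2
  have := Complex.zero_le_real.mp h2
  linarith

lemma real_bound (B : Fin 3 → Fin 3 → ℝ)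
    (h : ∀ g w : Fin 3 → ℝ, g 0 ^ 2 + g 1 ^ 2 + g 2 ^ 2 ≤ 1 → w 0 ^ 2 + w 1 ^ 2 + w 2 ^ 2 ≤ 1 →
      0 ≤ 1 + ∑ i, g i * ∑ j, B i j * w j) (w : Fin 3 → ℝ) :
    ∑ i, (∑ j, B i j * w j) ^ 2 ≤ ∑ j, w j ^ 2 := by
  set u : Fin 3 → ℝ := fun i => ∑ j, B i j * w j with hu
  set U := ∑ i, u i ^ 2 with hU
  set W := ∑ i, w i ^ 2 with hW
  have hU0 : 0 ≤ U := Finset.sum_nonneg fun i _ => sq_nonneg _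
  have hW0 : 0 ≤ W := Finset.sum_nonneg fun i _ => sq_nonneg _
  change U ≤ W
  rcases hW0.eq_or_lt with h0 | hWp
  · have : ∀ j, w j = 0 := fun j => by
      have := (Finset.sum_eq_zero_iff_of_nonneg (fun i _ => sq_nonneg (w i))).mp h0.symm j
        (Finset.mem_univ _)
      exact pow_eq_zero_iff (two_ne_zero) |>.mp this
    simp [hU, hu, this, hW]
  rcases hU0.eq_or_lt with h0 | hUp
  · linarith
  have sU := Real.sqrt_pos.mpr hUp
  have sW := Real.sqrt_pos.mpr hWp
  have qU := Real.sq_sqrt hU0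
  have qW := Real.sq_sqrt hW0
  have k := h (fun i => -(u i / √U)) (fun j => w j / √W)
    (by
      have : u 0 ^ 2 + u 1 ^ 2 + u 2 ^ 2 = U := by rw [hU, Fin.sum_univ_three]
      simp only [neg_sq, div_pow, qU, ← add_div, this]
      rw [div_self hUp.ne'])
    (by
      have : w 0 ^ 2 + w 1 ^ 2 + w 2 ^ 2 = W := by rw [hW, Fin.sum_univ_three]
      simp only [div_pow, qW, ← add_div, this]
      rw [div_self hWp.ne'])
  have e : ∑ i, -(u i / √U) * ∑ j, B i j * (w j / √W) = - (√U / √W) := by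
    have : ∀ i, ∑ j, B i j * (w j / √W) = u i / √W := fun i => by
      simp only [hu, Finset.sum_div, mul_div_assoc]
    simp only [this]
    have : ∀ i, -(u i / √U) * (u i / √W) = -(u i ^ 2 / (√U * √W)) := fun i => by
      field_simp
    simp only [this, Finset.sum_neg_distrib, ← Finset.sum_div, ← hU]
    rw [neg_inj, div_eq_div_iff (by positivity) (by positivity)]
    linear_combination (-√W) * qU
  rw [e] at k
  have k2 : √U / √W ≤ 1 := by linarith
  rw [div_le_one sW] at k2
  exact (Real.sqrt_le_sqrt_iff hW0).mp k2

/-- If `Δ` is a q.q.o. with Haar state `τ` and canonical representation with real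
coefficients `b`, then for every `f` in the closed unit ball of `ℝ³` the matrix
`𝔹(f)` with entries `𝔹(f)_{ij} = ∑_k b_{ki,j} f_k` has operator norm (as an
operator on Euclidean `ℂ³`) at most `1`. -/
theorem Bmat_norm_le_one (Δ : M2 →ₗ[ℂ] M4) (hQQO : IsQQO Δ) (hHaar : HaarTau Δ)
    (b : Fin 3 → Fin 3 → Fin 3 → ℝ)
    (hb : ∀ (w₀ : ℂ) (w : Fin 3 → ℂ),
        Δ (w₀ • (1 : M2) + ∑ k, w k • Pauli k)
          = w₀ • (1 : M4)
            + ∑ m, ∑ l, (∑ k, (b m l k : ℂ) * w k) • (Pauli m ⊗ₖ Pauli l)) :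
    ∀ f : Fin 3 → ℝ, f 0 ^ 2 + f 1 ^ 2 + f 2 ^ 2 ≤ 1 →
      ∀ v : EuclideanSpace ℂ (Fin 3),
        ‖Matrix.toEuclideanLin
            (Matrix.of fun i j : Fin 3 => ((∑ k, b k i j * f k : ℝ) : ℂ)) v‖ ≤ ‖v‖ := by
  intro f hf v
  set B : Fin 3 → Fin 3 → ℝ := fun i j => ∑ k, b k i j * f k with hB
  have rb := real_bound B (fun g w hg hw => by
    have := key Δ hQQO b hb f g w hf hg hw
    convert this using 2
    simp only [hB, Fin.sum_univ_three]
    ring)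
  have h1 := rb (fun j => (v j).re)
  have h2 := rb (fun j => (v j).im)
  rw [EuclideanSpace.norm_eq, EuclideanSpace.norm_eq]
  apply Real.sqrt_le_sqrt
  have e : ∀ z : ℂ, ‖z‖ ^ 2 = z.re ^ 2 + z.im ^ 2 := fun z => by
    rw [Complex.sq_norm, Complex.normSq_apply]; ring
  simp only [e, Finset.sum_add_distrib]
  refine add_le_add (le_trans (le_of_eq ?_) h1) (le_trans (le_of_eq ?_) h2)
  · refine Finset.sum_congr rfl fun i _ => ?_
    rw [Matrix.ofLp_toEuclideanLin_apply]
    simp only [Matrix.mulVec, dotProduct, Matrix.of_apply, Complex.re_sum, Complex.re_ofReal_mul, hB]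
  · refine Finset.sum_congr rfl fun i _ => ?_
    rw [Matrix.ofLp_toEuclideanLin_apply]
    simp only [Matrix.mulVec, dotProduct, Matrix.of_apply, Complex.im_sum, Complex.im_ofReal_mul, hB]
end

section
/- For every real w = (ω₁,ω₂,ω₃) ∈ ℝ³, the 4×4 matrix B(w) = ω₁(σ₁⊗σ₁ + σ₂⊗σ₃ + σ₃⊗σ₂) + ω₂(σ₁⊗σ₃ + σ₂⊗σ₂ + σ₃⊗σ₁) + ω₃(σ₁⊗σ₂ + σ₂⊗σ₁ + σ₃⊗σ₃) has characteristic polynomial (λ + s)²·((λ − s)² − 4q), where s = ω₁+ω₂+ω₃ and q = ω₁²+ω₂²+ω₃² − ω₁ω₂ − ω₁ω₃ − ω₂ω₃; in particular its eigenvalues are s + 2√q, s − 2√q, and −s with multiplicity two. -/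
open Matrix Complex Kronecker Polynomial

/-- The matrix
`B(w) = ω₁(σ₁⊗σ₁+σ₂⊗σ₃+σ₃⊗σ₂) + ω₂(σ₁⊗σ₃+σ₂⊗σ₂+σ₃⊗σ₁) + ω₃(σ₁⊗σ₂+σ₂⊗σ₁+σ₃⊗σ₃)`. -/
noncomputable def Bmat (w : Fin 3 → ℝ) : M4 :=
  (w 0 : ℂ) • (Pauli 0 ⊗ₖ Pauli 0 + Pauli 1 ⊗ₖ Pauli 2 + Pauli 2 ⊗ₖ Pauli 1)
  + (w 1 : ℂ) • (Pauli 0 ⊗ₖ Pauli 2 + Pauli 1 ⊗ₖ Pauli 1 + Pauli 2 ⊗ₖ Pauli 0)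
  + (w 2 : ℂ) • (Pauli 0 ⊗ₖ Pauli 1 + Pauli 1 ⊗ₖ Pauli 0 + Pauli 2 ⊗ₖ Pauli 2)

theorem Bmat_explicit (w : Fin 3 → ℝ) :
    Matrix.reindex finProdFinEquiv finProdFinEquiv (Bmat w) =
      (!![(w 2 : ℂ), w 1 - I * w 0, w 1 - I * w 0, w 0 - w 1 - 2 * I * w 2;
         w 1 + I * w 0, -w 2, w 0 + w 1, I * w 0 - w 1;
         w 1 + I * w 0, w 0 + w 1, -w 2, I * w 0 - w 1;
         w 0 - w 1 + 2 * I * w 2, -I * w 0 - w 1, -I * w 0 - w 1, w 2] :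
        Matrix (Fin (2 * 2)) (Fin (2 * 2)) ℂ) := by
  have h0 : (finProdFinEquiv.symm (0 : Fin (2*2)) : Fin 2 × Fin 2) = (0, 0) := by decide
  have h1 : (finProdFinEquiv.symm (1 : Fin (2*2)) : Fin 2 × Fin 2) = (0, 1) := by decide
  have h2 : (finProdFinEquiv.symm (2 : Fin (2*2)) : Fin 2 × Fin 2) = (1, 0) := by decide
  have h3 : (finProdFinEquiv.symm (3 : Fin (2*2)) : Fin 2 × Fin 2) = (1, 1) := by decide
  ext i j
  rw [Matrix.reindex_apply, Matrix.submatrix_apply]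
  change Fin 4 at i j
  fin_cases i <;> fin_cases j <;>
  simp only [Fin.mk_zero, Fin.mk_one, Fin.reduceFinMk, Fin.zero_eta, h0, h1, h2, h3] <;>
  simp [Bmat, Pauli, Matrix.kroneckerMap_apply] <;> ring

theorem Bmat_cp (w : Fin 3 → ℝ) :
    (Bmat w).charpoly
        = (X + C ((w 0 + w 1 + w 2 : ℝ) : ℂ)) ^ 2 *
          ((X - C ((w 0 + w 1 + w 2 : ℝ) : ℂ)) ^ 2
            - C ((4 * (w 0 ^ 2 + w 1 ^ 2 + w 2 ^ 2
                - w 0 * w 1 - w 0 * w 2 - w 1 * w 2) : ℝ) : ℂ)) := by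
  have hI : (C I : ℂ[X]) ^ 2 = -1 := by rw [← C_pow, I_sq]; simp
  rw [← Matrix.charpoly_reindex finProdFinEquiv, Bmat_explicit]
  change Matrix.charpoly (n := Fin 4) _ = _
  rw [Matrix.charpoly, Matrix.det_succ_row_zero]
  simp [Fin.sum_univ_succ, Matrix.det_fin_three, Matrix.charmatrix_apply, Fin.succAbove,
    Matrix.diagonal_apply]
  generalize (C I : ℂ[X]) = i at *
  have h4 : (C 4 : ℂ[X]) = 4 := rfl
  have h2 : (C 2 : ℂ[X]) = 2 := rfl
  simp only [h4, h2]
  generalize (C (w 0 : ℂ) : ℂ[X]) = a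
  generalize (C (w 1 : ℂ) : ℂ[X]) = b
  generalize (C (w 2 : ℂ) : ℂ[X]) = c
  grind

/-- The characteristic polynomial of `B(w)` is `(λ+s)²((λ−s)²−4q)` where
`s = ω₁+ω₂+ω₃` and `q = ω₁²+ω₂²+ω₃²−ω₁ω₂−ω₁ω₃−ω₂ω₃`; in particular the
eigenvalues are `s + 2√q`, `s − 2√q` and `−s` (with multiplicity two). -/
theorem Bmat_charpoly (w : Fin 3 → ℝ) :
    (Bmat w).charpoly
        = (X + C ((w 0 + w 1 + w 2 : ℝ) : ℂ)) ^ 2 *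
          ((X - C ((w 0 + w 1 + w 2 : ℝ) : ℂ)) ^ 2
            - C ((4 * (w 0 ^ 2 + w 1 ^ 2 + w 2 ^ 2
                - w 0 * w 1 - w 0 * w 2 - w 1 * w 2) : ℝ) : ℂ)) ∧
      (Bmat w).charpoly
        = (X - C (((w 0 + w 1 + w 2) + 2 * Real.sqrt (w 0 ^ 2 + w 1 ^ 2 + w 2 ^ 2
              - w 0 * w 1 - w 0 * w 2 - w 1 * w 2) : ℝ) : ℂ)) *
          (X - C (((w 0 + w 1 + w 2) - 2 * Real.sqrt (w 0 ^ 2 + w 1 ^ 2 + w 2 ^ 2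
              - w 0 * w 1 - w 0 * w 2 - w 1 * w 2) : ℝ) : ℂ)) *
          (X + C ((w 0 + w 1 + w 2 : ℝ) : ℂ)) ^ 2 := by
  refine ⟨Bmat_cp w, ?_⟩
  rw [Bmat_cp w]
  have hq : 0 ≤ w 0 ^ 2 + w 1 ^ 2 + w 2 ^ 2 - w 0 * w 1 - w 0 * w 2 - w 1 * w 2 := by
    nlinarith [sq_nonneg (w 0 - w 1), sq_nonneg (w 0 - w 2), sq_nonneg (w 1 - w 2)]
  generalize w 0 ^ 2 + w 1 ^ 2 + w 2 ^ 2 - w 0 * w 1 - w 0 * w 2 - w 1 * w 2 = q at *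
  obtain ⟨r, hr⟩ : ∃ r, r = Real.sqrt q := ⟨_, rfl⟩
  have hrq : q = r ^ 2 := by rw [hr, Real.sq_sqrt hq]
  rw [← hr, hrq]
  have h4 : (C 4 : ℂ[X]) = 4 := rfl
  have h2 : (C 2 : ℂ[X]) = 2 := rfl
  push_cast
  simp only [C_add, C_sub, C_mul, C_pow, h4, h2]
  ring
end

section
/- For every real w = (ω₁,ω₂,ω₃) ∈ ℝ³ with ω₁²+ω₂²+ω₃² ≤ 1, setting s = ω₁+ω₂+ω₃ and q = ω₁²+ω₂²+ω₃² − ω₁ω₂ − ω₁ω₃ − ω₂ω₃, one has −3 ≤ s − 2√q, s + 2√q ≤ 3, and |s| ≤ √3. Consequently every eigenvalue of the matrix B(w) = ω₁(σ₁⊗σ₁ + σ₂⊗σ₃ + σ₃⊗σ₂) + ω₂(σ₁⊗σ₃ + σ₂⊗σ₂ + σ₃⊗σ₁) + ω₃(σ₁⊗σ₂ + σ₂⊗σ₁ + σ₃⊗σ₃) lies in the interval [−3, 3]. -/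
open Matrix Complex Kronecker Polynomial

set_option maxHeartbeats 4000000 in
theorem Bmat_annihilated (w : Fin 3 → ℝ) (s q : ℂ) (hs : s = w 0 + w 1 + w 2)
    (hq : q = (w 0 : ℂ) ^ 2 + w 1 ^ 2 + w 2 ^ 2 - w 0 * w 1 - w 0 * w 2 - w 1 * w 2) :
    (Bmat w + s • (1 : M4)) * (Bmat w * Bmat w - (2 * s) • Bmat w
      + (s ^ 2 - 4 * q) • (1 : M4)) = 0 := by
  subst hs hq
  have hI : Complex.I ^ 2 = -1 := Complex.I_sq
  have hI3 : Complex.I ^ 3 = -Complex.I := by rw [pow_succ, hI]; ring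
  have hI4 : Complex.I ^ 4 = 1 := Complex.I_pow_four
  ext ⟨i1, i2⟩ ⟨j1, j2⟩
  fin_cases i1 <;> fin_cases i2 <;> fin_cases j1 <;> fin_cases j2 <;>
    simp [Bmat, Pauli, Matrix.mul_apply, Fintype.sum_prod_type, Matrix.one_apply] <;>
    ring_nf <;> simp only [hI, hI3, hI4] <;> ring

/-- For `w` in the closed unit ball of `ℝ³`, with `s = ω₁+ω₂+ω₃` and
`q = ω₁²+ω₂²+ω₃²−ω₁ω₂−ω₁ω₃−ω₂ω₃`, one has `−3 ≤ s − 2√q`, `s + 2√q ≤ 3` and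
`|s| ≤ √3`; consequently every eigenvalue of `B(w)` lies in `[−3, 3]`. -/
theorem Bmat_eigenvalues_bounded (w : Fin 3 → ℝ)
    (hw : w 0 ^ 2 + w 1 ^ 2 + w 2 ^ 2 ≤ 1) :
    (-3 ≤ (w 0 + w 1 + w 2)
        - 2 * Real.sqrt (w 0 ^ 2 + w 1 ^ 2 + w 2 ^ 2
            - w 0 * w 1 - w 0 * w 2 - w 1 * w 2)) ∧
    ((w 0 + w 1 + w 2)
        + 2 * Real.sqrt (w 0 ^ 2 + w 1 ^ 2 + w 2 ^ 2
            - w 0 * w 1 - w 0 * w 2 - w 1 * w 2) ≤ 3) ∧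
    |w 0 + w 1 + w 2| ≤ Real.sqrt 3 ∧
    ∀ μ : ℂ, μ ∈ spectrum ℂ (Bmat w) → μ.im = 0 ∧ -3 ≤ μ.re ∧ μ.re ≤ 3 := by
  set s := w 0 + w 1 + w 2 with hs
  set q := w 0 ^ 2 + w 1 ^ 2 + w 2 ^ 2 - w 0 * w 1 - w 0 * w 2 - w 1 * w 2 with hq
  have hq0 : 0 ≤ q := by
    nlinarith [sq_nonneg (w 0 - w 1), sq_nonneg (w 0 - w 2), sq_nonneg (w 1 - w 2)]
  have hqs : 2 * q + s ^ 2 ≤ 3 := by rw [hq, hs]; nlinarith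
  have hs3 : s ^ 2 ≤ 3 := by linarith
  have hsabs : |s| ≤ Real.sqrt 3 := Real.abs_le_sqrt hs3
  have hsl : -3 ≤ s ∧ s ≤ 3 := by constructor <;> nlinarith
  have hr0 := Real.sqrt_nonneg q
  have hr2 : Real.sqrt q ^ 2 = q := Real.sq_sqrt hq0
  set r := Real.sqrt q with hr
  have h1 : -3 ≤ s - 2 * r := by
    have : 2 * r ≤ 3 + s := abs_le_of_sq_le_sq' (by nlinarith [sq_nonneg (s + 1)]) (by linarith) |>.2
    linarith
  have h2 : s + 2 * r ≤ 3 := by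
    have : 2 * r ≤ 3 - s := abs_le_of_sq_le_sq' (by nlinarith [sq_nonneg (s - 1)]) (by linarith) |>.2
    linarith
  refine ⟨h1, h2, hsabs, fun μ hμ => ?_⟩
  have hann := Bmat_annihilated w (s : ℂ) (q : ℂ) (by rw [hs]; push_cast; rfl)
    (by rw [hq]; push_cast; rfl)
  let p : ℂ[X] := (X + C (s : ℂ)) * (X * X - C (2 * (s : ℂ)) * X + C ((s : ℂ) ^ 2 - 4 * q))
  have hp : aeval (Bmat w) p = 0 := by
    rw [← hann]
    simp only [p, map_mul, map_add, map_sub, aeval_X, aeval_C, Algebra.algebraMap_eq_smul_one,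
      smul_mul_assoc, one_mul, mul_smul, sub_smul]
  have hmem : p.eval μ ∈ spectrum ℂ (aeval (Bmat w) p) :=
    spectrum.subset_polynomial_aeval (Bmat w) p ⟨μ, hμ, rfl⟩
  rw [hp, spectrum.zero_eq, Set.mem_singleton_iff] at hmem
  have hq2 : (q : ℂ) = (r : ℂ) ^ 2 := by rw [← hr2]; push_cast; rfl
  have hfac : (μ + s) * ((μ - (s + 2 * r)) * (μ - (s - 2 * r))) = 0 := by
    rw [← hmem]
    simp only [p, eval_mul, eval_add, eval_sub, eval_X, eval_C, hq2]
    ring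
  have hreal : ∃ x : ℝ, μ = x ∧ -3 ≤ x ∧ x ≤ 3 := by
    rcases mul_eq_zero.1 hfac with h | h
    · exact ⟨-s, by push_cast; linear_combination h, by linarith, by linarith⟩
    · rcases mul_eq_zero.1 h with h | h
      · exact ⟨s + 2 * r, by push_cast; linear_combination h, by linarith, h2⟩
      · exact ⟨s - 2 * r, by push_cast; linear_combination h, h1, by linarith⟩
  obtain ⟨x, rfl, hx⟩ := hreal
  exact ⟨Complex.ofReal_im x, by simpa using hx⟩
end

section
/- For ε ∈ ℝ, the linear map Δ_ε is a quantum quadratic operator (i.e. Δ_ε is unital and maps positive semidefinite matrices to positive semidefinite matrices) if and only if |ε| ≤ 1/3. -/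
open Matrix Complex Kronecker ComplexOrder

/-- `σ₁⊗σ₁ + σ₂⊗σ₃ + σ₃⊗σ₂`. -/
noncomputable def K1 : M4 := Pauli 0 ⊗ₖ Pauli 0 + Pauli 1 ⊗ₖ Pauli 2 + Pauli 2 ⊗ₖ Pauli 1

/-- `σ₁⊗σ₃ + σ₂⊗σ₂ + σ₃⊗σ₁`. -/
noncomputable def K2 : M4 := Pauli 0 ⊗ₖ Pauli 2 + Pauli 1 ⊗ₖ Pauli 1 + Pauli 2 ⊗ₖ Pauli 0

/-- `σ₁⊗σ₂ + σ₂⊗σ₁ + σ₃⊗σ₃`. -/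
noncomputable def K3 : M4 := Pauli 0 ⊗ₖ Pauli 1 + Pauli 1 ⊗ₖ Pauli 0 + Pauli 2 ⊗ₖ Pauli 2

/-- `Δ` is the map `Δ_ε`, i.e. on `x = w₀·1 + w·σ` it is given by
`Δ_ε(x) = w₀·(1⊗1) + ε[w₁ K1 + w₂ K2 + w₃ K3]`. -/
def IsDeltaEps (ε : ℝ) (Δ : M2 →ₗ[ℂ] M4) : Prop :=
  ∀ (w₀ : ℂ) (w : Fin 3 → ℂ),
    Δ (w₀ • (1 : M2) + ∑ k, w k • Pauli k)
      = w₀ • (1 : M4) + (ε : ℂ) • (w 0 • K1 + w 1 • K2 + w 2 • K3)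

lemma aux_cs (ε w0 w1 w2 w3 k1 k2 k3 n : ℝ) (he : |ε| ≤ 1/3) (h0 : 0 ≤ w0) (hn : 0 ≤ n)
    (hw : w1^2+w2^2+w3^2 ≤ w0^2) (hk : k1^2+k2^2+k3^2 ≤ 9*n^2) :
    0 ≤ w0*n + ε*(w1*k1+w2*k2+w3*k3) := by
  have h1 : (w1*k1+w2*k2+w3*k3)^2 ≤ (3*(w0*n))^2 := by
    have hcs : (w1*k1+w2*k2+w3*k3)^2 ≤ (w1^2+w2^2+w3^2)*(k1^2+k2^2+k3^2) := by
      nlinarith [sq_nonneg (w1*k2-w2*k1), sq_nonneg (w1*k3-w3*k1), sq_nonneg (w2*k3-w3*k2)]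
    have : (w1^2+w2^2+w3^2)*(k1^2+k2^2+k3^2) ≤ w0^2*(9*n^2) :=
      mul_le_mul hw hk (by positivity) (by positivity)
    nlinarith
  have h2 := abs_le_of_sq_le_sq h1 (by positivity)
  have h3 : |ε*(w1*k1+w2*k2+w3*k3)| ≤ 1/3*(3*(w0*n)) := by
    rw [abs_mul]
    exact mul_le_mul he (h2) (abs_nonneg _) (by norm_num)
  have := (abs_le.mp h3).1
  linarith

lemma aux_trip (ε w0 w1 w2 w3 x y z : ℝ) (he : |ε| ≤ 1/3) (h0 : 0 ≤ w0)
    (hw : w1^2+w2^2+w3^2 ≤ w0^2) :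
    0 ≤ w0*(x^2+y^2+z^2) + ε*(w1*(y^2+z^2-x^2-4*(y*z))+w2*(x^2+z^2-y^2-4*(x*z))
      +w3*(x^2+y^2-z^2-4*(x*y))) := by
  -- M_2 : entries 22, 13 ; M_3 : entries 33, 12
  apply aux_cs ε w0 w1 w2 w3 _ _ _ _ he h0 (by positivity) hw
  have h1 : 0 ≤ (x+y+z)^2 := sq_nonneg _
  have h2 : 0 ≤ 3*(x^2+y^2+z^2) - 2*(x*y+y*z+z*x) := by
    nlinarith [sq_nonneg (x-y), sq_nonneg (y-z), sq_nonneg (z-x), sq_nonneg x, sq_nonneg y, sq_nonneg z]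
  nlinarith [mul_nonneg h1 h2]

lemma aux_sing (ε w0 w1 w2 w3 x : ℝ) (he : |ε| ≤ 1/3) (h0 : 0 ≤ w0)
    (hw : w1^2+w2^2+w3^2 ≤ w0^2) :
    0 ≤ w0*x^2 + ε*(w1*(-x^2)+w2*(-x^2)+w3*(-x^2)) := by
  apply aux_cs ε w0 w1 w2 w3 _ _ _ _ he h0 (by positivity) hw
  nlinarith [sq_nonneg (x^2)]

lemma aux_pos (ε w0 w1 w2 w3 : ℝ) (he : |ε| ≤ 1/3) (h0 : 0 ≤ w0)
    (hw : w1^2+w2^2+w3^2 ≤ w0^2) :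
    ((w0:ℂ) • (1 : M4) + (ε : ℂ) • ((w1:ℂ) • K1 + (w2:ℂ) • K2 + (w3:ℂ) • K3)).PosSemidef := by
  apply Matrix.PosSemidef.of_dotProduct_mulVec_nonneg
  · ext ⟨i, j⟩ ⟨k, l⟩
    fin_cases i <;> fin_cases j <;> fin_cases k <;> fin_cases l <;>
      simp [K1, K2, K3, Pauli, Matrix.one_apply, Complex.ext_iff]
  · intro v
    rw [Complex.le_def]
    generalize ha : v (0,0) = a
    generalize hb : v (0,1) = b
    generalize hc : v (1,0) = c
    generalize hd : v (1,1) = d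
    have key := fun x y z => aux_trip ε w0 w1 w2 w3 x y z he h0 hw
    have e1 := key (a.re-d.re) (-(a.im+d.im)) (-(b.re+c.re))
    have e2 := key (a.im-d.im) ((a.re+d.re)) (-(b.im+c.im))
    have e3 := aux_sing ε w0 w1 w2 w3 (b.re-c.re) he h0 hw
    have e4 := aux_sing ε w0 w1 w2 w3 (b.im-c.im) he h0 hw
    constructor
    · simp [dotProduct, Matrix.mulVec, Fintype.sum_prod_type, K1, K2, K3, Pauli, Matrix.one_apply, ha, hb, hc, hd]
      linarith
    · simp [dotProduct, Matrix.mulVec, Fintype.sum_prod_type, K1, K2, K3, Pauli, Matrix.one_apply, ha, hb, hc, hd]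
      ring

lemma aux_fwd (ε s : ℝ) 
    (h : ((1:ℂ) • (1 : M4) + (ε : ℂ) • ((0:ℂ) • K1 + (0:ℂ) • K2 + (s:ℂ) • K3)).PosSemidef) :
    0 ≤ 1 + 3*ε*s := by
  have := h.dotProduct_mulVec_nonneg (fun p => if p = (0,0) then 1 else if p = (1,1) then Complex.I else 0)
  rw [Complex.le_def] at this
  have := this.1
  simp [dotProduct, Matrix.mulVec, Fintype.sum_prod_type, K3, Pauli, Matrix.one_apply] at this
  linarith

lemma aux_dec (x : M2) (hx : x.PosSemidef) : ∃ w0 w1 w2 w3 : ℝ, 0 ≤ w0 ∧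
    w1^2+w2^2+w3^2 ≤ w0^2 ∧
    x = (w0:ℂ) • (1 : M2) + ∑ k, (![(w1:ℂ), w2, w3] : Fin 3 → ℂ) k • Pauli k := by
  have hd := hx.det_nonneg
  have h00 := hx.diag_nonneg (i := 0)
  have h11 := hx.diag_nonneg (i := 1)
  have h10 := hx.isHermitian.apply 1 0
  rw [Matrix.det_fin_two, ← h10, Complex.le_def] at hd
  rw [Complex.le_def] at h00 h11
  have := hd.1
  simp at this h00 h11
  obtain ⟨a1, a2⟩ := h00
  obtain ⟨b1, b2⟩ := h11
  refine ⟨((x 0 0).re + (x 1 1).re)/2, (x 0 1).re, -(x 0 1).im, ((x 0 0).re - (x 1 1).re)/2,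
    by positivity, ?_, ?_⟩
  · rw [← a2, ← b2] at this
    nlinarith
  · ext i j
    fin_cases i <;> fin_cases j <;>
      simp [Fin.sum_univ_three, Pauli, Complex.ext_iff, ← a2, ← b2, ← h10] <;> ring

lemma aux_psd (s : ℝ) (hs : s^2 = 1) :
    ((1:ℂ) • (1 : M2) + ∑ k, (![0, 0, (s:ℂ)] : Fin 3 → ℂ) k • Pauli k).PosSemidef := by
  have : ((1:ℂ) • (1 : M2) + ∑ k, (![0, 0, (s:ℂ)] : Fin 3 → ℂ) k • Pauli k)
    = Matrix.diagonal ![((1+s : ℝ):ℂ), ((1-s:ℝ):ℂ)] := by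
    ext i j
    fin_cases i <;> fin_cases j <;> simp [Fin.sum_univ_three, Pauli, sub_eq_add_neg]
  rw [this, Matrix.posSemidef_diagonal_iff]
  intro i
  fin_cases i
  · simp only [Fin.zero_eta, Matrix.cons_val_zero]
    exact Complex.zero_le_real.mpr (by nlinarith)
  · simp only [Fin.mk_one, Matrix.cons_val_one]
    exact Complex.zero_le_real.mpr (by nlinarith)

/-- `Δ_ε` is a quantum quadratic operator (unital and positive) iff `|ε| ≤ 1/3`. -/
theorem deltaEps_qqo_iff (ε : ℝ) (Δ : M2 →ₗ[ℂ] M4) (hΔ : IsDeltaEps ε Δ) :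
    (Δ 1 = 1 ∧ ∀ x : M2, x.PosSemidef → (Δ x).PosSemidef) ↔ |ε| ≤ 1 / 3 := by
  constructor
  · rintro ⟨-, h⟩
    have key : ∀ s : ℝ, s^2 = 1 → 0 ≤ 1 + 3*ε*s := by
      intro s hs
      have h1 := h _ (aux_psd s hs)
      rw [hΔ] at h1
      exact aux_fwd ε s h1
    have k1 := key 1 (by norm_num)
    have k2 := key (-1) (by norm_num)
    rw [abs_le]
    constructor <;> linarith
  · intro he
    refine ⟨by simpa using hΔ 1 0, ?_⟩
    intro x hx
    obtain ⟨w0, w1, w2, w3, h0, hw, rfl⟩ := aux_dec x hx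
    rw [hΔ]
    exact aux_pos ε w0 w1 w2 w3 he h0 hw
end

section
/- For ε = 1/3, the quantum quadratic operator Δ_ε is not a Kadison–Schwarz operator: there exists x ∈ M₂(ℂ) such that Δ_{1/3}(x*x) − Δ_{1/3}(x)*Δ_{1/3}(x) is not positive semidefinite. (One may take x = w·σ with w = (−1/9, 5/36, 5i/27).) -/
open Matrix Complex Kronecker ComplexOrder

/-- For `ε = 1/3` the q.q.o. `Δ_ε` is not a Kadison–Schwarz operator: there is
`x ∈ M₂(ℂ)` with `Δ(x*x) − Δ(x)*Δ(x)` not positive semidefinite. -/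
theorem deltaEps_not_ks (Δ : M2 →ₗ[ℂ] M4) (hΔ : IsDeltaEps (1 / 3) Δ) :
    ∃ x : M2, ¬ (Δ (xᴴ * x) - (Δ x)ᴴ * Δ x).PosSemidef := by
  refine ⟨!![0, 2; 0, 0], fun h => ?_⟩
  have h1 := hΔ 0 ![1, Complex.I, 0]
  have h2 := hΔ 2 ![0, 0, -2]
  have e1 : ((0 : ℂ) • (1 : M2) + ∑ k, (![1, Complex.I, 0] : Fin 3 → ℂ) k • Pauli k)
      = !![0, 2; 0, 0] := by
    ext i j
    fin_cases i <;> fin_cases j <;> simp [Fin.sum_univ_three, Pauli] <;> norm_num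
  have e2 : ((2 : ℂ) • (1 : M2) + ∑ k, (![0, 0, -2] : Fin 3 → ℂ) k • Pauli k)
      = (!![0, 2; 0, 0] : M2)ᴴ * !![0, 2; 0, 0] := by
    ext i j
    fin_cases i <;> fin_cases j <;>
      simp [Fin.sum_univ_three, Pauli, Matrix.mul_apply, Fin.sum_univ_two] <;>
      norm_num [Complex.ext_iff]
  rw [e1] at h1
  rw [e2] at h2
  rw [h1, h2] at h
  have h3 := h.dotProduct_mulVec_nonneg
    (fun p : Fin 2 × Fin 2 => (!![1, 0; 0, Complex.I] : M2) p.1 p.2)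
  have h4 := (Complex.le_def.1 h3).1
  simp [dotProduct, Matrix.mulVec, Matrix.mul_apply, Fintype.sum_prod_type,
    Fin.sum_univ_two, K1, K2, K3, Pauli, Matrix.one_apply] at h4
  norm_num at h4
end

section
/- For ε ∈ ℝ, the linear map Δ_ε : M₂(ℂ) → M₄(ℂ) is completely positive (i.e. for every n, the induced map on M₂(M_n(ℂ)) sending a block matrix (a_{ij}) to (Δ_ε(a_{ij})) maps positive semidefinite matrices to positive semidefinite matrices) if and only if |ε| ≤ 1/(3√3). -/
open Matrix Complex Kronecker ComplexOrder

noncomputable def MM : Matrix (Fin 2 × (Fin 2 × Fin 2)) (Fin 2 × (Fin 2 × Fin 2)) ℂ :=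
  Pauli 0 ⊗ₖ K1 - Pauli 1 ⊗ₖ K2 + Pauli 2 ⊗ₖ K3

def e8 (p : Fin 2 × (Fin 2 × Fin 2)) : Fin 8 :=
  ⟨4 * p.1.1 + 2 * p.2.1.1 + p.2.2.1, by omega⟩

noncomputable def L8 : Matrix (Fin 8) (Fin 8) ℂ :=
  !![1, 0, 0, -2*I, 0, 0, 0, 1-I;
     0, -1, 0, 0, 2*I, 0, 1+I, 0;
     0, 0, -1, 0, 2*I, 1+I, 0, 0;
     2*I, 0, 0, 1, 1-I, -2*I, -2*I, 0;
     0, -2*I, -2*I, 1+I, -1, 0, 0, 2*I;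
     0, 0, 1-I, 2*I, 0, 1, 0, 0;
     0, 1-I, 0, 2*I, 0, 0, 1, 0;
     1+I, 0, 0, 0, -2*I, 0, 0, -1]

noncomputable def T8 : Matrix (Fin 8) (Fin 8) ℂ :=
  !![20, 0, 0, 4*I, 4+4*I, 4, 4, 0;
     0, 20, -4, 4-4*I, 4*I, 0, 0, 4;
     0, -4, 20, 4-4*I, 4*I, 0, 0, 4;
     -4*I, 4+4*I, 4+4*I, 12, 0, 4*I, 4*I, -4-4*I;
     4-4*I, -4*I, -4*I, 0, 12, -4+4*I, -4+4*I, 4*I;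
     4, 0, 0, -4*I, -4-4*I, 20, -4, 0;
     4, 0, 0, -4*I, -4-4*I, -4, 20, 0;
     0, 4, 4, -4+4*I, -4*I, 0, 0, 20]

theorem e8_bij : Function.Bijective e8 := by decide

theorem MM_eq : MM = L8.submatrix e8 e8 := by
  ext ⟨i, p, q⟩ ⟨j, r, s⟩
  fin_cases i <;> fin_cases p <;> fin_cases q <;> fin_cases j <;> fin_cases r <;> fin_cases s <;>
    simp [MM, L8, e8, K1, K2, K3, Pauli, kroneckerMap_apply, sub_eq_add_neg] <;> ring_nf <;> simp

theorem L8_sq : L8 * L8 = (27 : ℂ) • 1 - T8 := by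
  ext i j
  fin_cases i <;> fin_cases j <;>
    simp [L8, T8, Matrix.mul_apply, Fin.sum_univ_succ] <;> ring_nf <;> simp <;> ring_nf

theorem T8_sq : T8 * T8 = (24 : ℂ) • T8 := by
  ext i j
  fin_cases i <;> fin_cases j <;>
    simp [T8, Matrix.mul_apply, Fin.sum_univ_succ] <;> ring_nf <;> simp <;> ring_nf

theorem L8_herm : L8ᴴ = L8 := by
  ext i j
  fin_cases i <;> fin_cases j <;> simp [L8, sub_eq_add_neg]

theorem T8_herm : T8ᴴ = T8 := by
  ext i j
  fin_cases i <;> fin_cases j <;> simp [T8, sub_eq_add_neg]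

theorem L8_psd (ε : ℝ) (h : 27 * ε ^ 2 ≤ 1) : (1 + (ε : ℂ) • L8).PosSemidef := by
  have e : 1 + (ε : ℂ) • L8 = (((1 / (54 * 24) : ℝ)) : ℂ) • (T8ᴴ * T8)
      + ((1 / 54 : ℝ) : ℂ) • ((L8 + ((27 * ε : ℝ) : ℂ) • 1)ᴴ * (L8 + ((27 * ε : ℝ) : ℂ) • 1))
      + (((1 - 27 * ε ^ 2) / 2 : ℝ) : ℂ) • 1 := by
    simp only [conjTranspose_add, conjTranspose_smul, conjTranspose_one, L8_herm, T8_herm, T8_sq,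
      add_mul, mul_add, L8_sq, smul_mul_assoc, mul_smul_comm, one_mul, mul_one]
    simp
    module
  rw [e]
  refine ((?_ : Matrix.PosSemidef _).add ?_).add ?_
  · exact (posSemidef_conjTranspose_mul_self _).smul (by norm_cast; norm_num)
  · exact (posSemidef_conjTranspose_mul_self _).smul (by norm_cast; norm_num)
  · exact PosSemidef.one.smul (by norm_cast; linarith)

noncomputable def CC (ε : ℝ) : Matrix (Fin 2 × (Fin 2 × Fin 2)) (Fin 2 × (Fin 2 × Fin 2)) ℂ :=
  1 + (ε : ℂ) • MM

theorem CC_eq (ε : ℝ) : CC ε = (1 + (ε : ℂ) • L8).submatrix e8 e8 := by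
  rw [CC, MM_eq]
  ext i j
  simp [Matrix.one_apply, e8_bij.1.eq_iff]

theorem Delta_apply (ε : ℝ) (Δ : M2 →ₗ[ℂ] M4) (hΔ : IsDeltaEps ε Δ) (x : M2) (p q : Fin 2 × Fin 2) :
    Δ x p q = (1 / 2 : ℂ) * ∑ a, ∑ b, x a b * CC ε (a, p) (b, q) := by
  have h := hΔ ((x 0 0 + x 1 1) / 2)
    ![(x 0 1 + x 1 0) / 2, I * (x 0 1 - x 1 0) / 2, (x 0 0 - x 1 1) / 2]
  have hx : ((x 0 0 + x 1 1) / 2) • (1 : M2) + ∑ k, (![(x 0 1 + x 1 0) / 2,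
      I * (x 0 1 - x 1 0) / 2, (x 0 0 - x 1 1) / 2] : Fin 3 → ℂ) k • Pauli k = x := by
    ext i j
    fin_cases i <;> fin_cases j <;> simp [Fin.sum_univ_succ, Pauli] <;> ring_nf <;> simp <;> ring_nf
  rw [hx] at h
  rw [h]
  simp [Fin.sum_univ_two, CC, MM, kroneckerMap_apply, Pauli, Matrix.one_apply]
  split_ifs <;> ring

theorem cp_of (ε : ℝ) (Δ : M2 →ₗ[ℂ] M4) (hΔ : IsDeltaEps ε Δ) (hC : (CC ε).PosSemidef)
    (n : ℕ) (A : Matrix (Fin n × Fin 2) (Fin n × Fin 2) ℂ) (hA : A.PosSemidef) :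
        (Matrix.of fun p q : Fin n × (Fin 2 × Fin 2) =>
          Δ (Matrix.of fun a b : Fin 2 => A (p.1, a) (q.1, b)) p.2 q.2).PosSemidef := by
  have key := ((hA.kronecker hC).submatrix
    (fun r : (Fin n × (Fin 2 × Fin 2)) × Fin 2 => ((r.1.1, r.2), (r.2, r.1.2)))).conjTranspose_mul_mul_same
    (Matrix.of fun (r : (Fin n × (Fin 2 × Fin 2)) × Fin 2) (p : Fin n × (Fin 2 × Fin 2)) =>
      if r.1 = p then (1 : ℂ) else 0)
  have key2 := key.smul (show (0 : ℂ) ≤ ((1 / 2 : ℝ) : ℂ) by norm_cast; norm_num)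
  refine Eq.mp (congrArg Matrix.PosSemidef (Eq.symm ?_)) key2
  ext p q
  simp only [Matrix.of_apply, Delta_apply ε Δ hΔ]
  rw [Matrix.smul_apply]
  simp only [Matrix.mul_apply, Fintype.sum_prod_type (α₁ := Fin n × (Fin 2 × Fin 2)), conjTranspose_apply, of_apply,
    submatrix_apply, kroneckerMap_apply, apply_ite star, star_one, star_zero, ite_mul, mul_ite, one_mul, mul_one,
    zero_mul, mul_zero]
  simp [Fin.sum_univ_two]
  ring

noncomputable def vv (k : ℝ) : Fin 8 → ℂ :=
  ![3 - k, -3 - 3*I, -3 - 3*I, (9 - k) * I, -k * (-1 + I), -3 + k, -3 + k, 3 + 3*I]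

theorem quad (ε k : ℝ) (hk : k ^ 2 = 27) :
    star (vv k) ⬝ᵥ ((1 + (ε : ℂ) • L8) *ᵥ vv k) = ((324 - 36 * k) * (1 - ε * k) : ℝ) := by
  have hk' : (k : ℂ) ^ 2 = 27 := by exact_mod_cast hk
  have e : L8 *ᵥ vv k = (-k : ℂ) • vv k := by
    ext i
    fin_cases i <;> simp [L8, vv, Matrix.mulVec, dotProduct, Fin.sum_univ_succ] <;> ring_nf <;> simp [hk'] <;> ring_nf
  have n : star (vv k) ⬝ᵥ vv k = ((324 - 36 * k : ℝ) : ℂ) := by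
    simp [vv, dotProduct, Fin.sum_univ_succ]
    ring_nf
    simp [hk', show (starRingEnd ℂ) 3 = 3 from map_ofNat _ 3, show (starRingEnd ℂ) 9 = 9 from map_ofNat _ 9]
    ring_nf
  rw [add_mulVec, one_mulVec, smul_mulVec, e, dotProduct_add, dotProduct_smul, dotProduct_smul, n]
  push_cast
  simp
  ring

theorem nec (ε : ℝ) (h : (CC ε).PosSemidef) : |ε| ≤ 1 / (3 * Real.sqrt 3) := by
  have h8 : (1 + (ε : ℂ) • L8).PosSemidef := by
    have := h.submatrix (Equiv.ofBijective e8 e8_bij).symm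
    rw [CC_eq, submatrix_submatrix] at this
    have e : e8 ∘ (Equiv.ofBijective e8 e8_bij).symm = id := by
      ext1 i
      exact (Equiv.ofBijective e8 e8_bij).apply_symm_apply i
    rwa [e, submatrix_id_id] at this
  have hs : Real.sqrt 3 ^ 2 = 3 := Real.sq_sqrt (by norm_num)
  have hp : 0 < Real.sqrt 3 := by positivity
  have q (k : ℝ) (hk : k ^ 2 = 27) : 0 ≤ 1 - ε * k := by
    have h1 := h8.dotProduct_mulVec_nonneg (vv k)
    rw [quad ε k hk] at h1
    have h2 : 0 ≤ (324 - 36 * k) * (1 - ε * k) := by exact_mod_cast h1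
    have h3 : 0 < 324 - 36 * k := by nlinarith
    exact nonneg_of_mul_nonneg_right h2 h3
  have a := q (3 * Real.sqrt 3) (by nlinarith)
  have b := q (-(3 * Real.sqrt 3)) (by nlinarith)
  rw [le_div_iff₀ (by positivity)]
  rcases abs_cases ε with ⟨h, _⟩ | ⟨h, _⟩ <;> rw [h] <;> linarith

theorem CC_of_cp (ε : ℝ) (Δ : M2 →ₗ[ℂ] M4) (hΔ : IsDeltaEps ε Δ)
    (H : ∀ (n : ℕ) (A : Matrix (Fin n × Fin 2) (Fin n × Fin 2) ℂ), A.PosSemidef →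
        (Matrix.of fun p q : Fin n × (Fin 2 × Fin 2) =>
          Δ (Matrix.of fun a b : Fin 2 => A (p.1, a) (q.1, b)) p.2 q.2).PosSemidef) :
    (CC ε).PosSemidef := by
  have h := H 2 (vecMulVec (fun p => if p.1 = p.2 then 1 else 0)
    (star (fun p => if p.1 = p.2 then 1 else 0))) (posSemidef_vecMulVec_self_star _)
  have h2 := h.smul (show (0 : ℂ) ≤ ((2 : ℝ) : ℂ) by norm_num)
  convert h2 using 1
  ext ⟨i, p⟩ ⟨j, q⟩
  rw [Matrix.smul_apply]
  simp only [Matrix.of_apply, Delta_apply ε Δ hΔ]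
  fin_cases i <;> fin_cases j <;> simp [vecMulVec_apply, Fin.sum_univ_two]

/-- `Δ_ε` is completely positive (for every `n` the induced map on block matrices
`(a_{ij}) ↦ (Δ_ε(a_{ij}))` preserves positive semidefiniteness) iff
`|ε| ≤ 1/(3√3)`. -/
theorem deltaEps_cp_iff (ε : ℝ) (Δ : M2 →ₗ[ℂ] M4) (hΔ : IsDeltaEps ε Δ) :
    (∀ (n : ℕ) (A : Matrix (Fin n × Fin 2) (Fin n × Fin 2) ℂ), A.PosSemidef →
        (Matrix.of fun p q : Fin n × (Fin 2 × Fin 2) =>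
          Δ (Matrix.of fun a b : Fin 2 => A (p.1, a) (q.1, b)) p.2 q.2).PosSemidef)
      ↔ |ε| ≤ 1 / (3 * Real.sqrt 3) := by
  constructor
  · intro H
    exact nec ε (CC_of_cp ε Δ hΔ H)
  · intro h n A hA
    refine cp_of ε Δ hΔ ?_ n A hA
    rw [CC_eq]
    refine (L8_psd ε ?_).submatrix _
    have hs : Real.sqrt 3 ^ 2 = 3 := Real.sq_sqrt (by norm_num)
    rw [le_div_iff₀ (by positivity)] at h
    have h2 := pow_le_pow_left₀ (by positivity) h 2
    rw [mul_pow, sq_abs, mul_pow, hs] at h2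
    linarith
end

section
/- For ε ∈ ℝ, the quadratic map V_ε maps the closed unit ball S into itself (V_ε(f) ∈ S for all f ∈ S) if and only if |ε| ≤ 1/√3. -/
/-- The quadratic operator
`V_ε(f) = (ε(f₁² + 2f₂f₃), ε(f₂² + 2f₁f₃), ε(f₃² + 2f₁f₂))` on `ℝ³`. -/
noncomputable def Veps (ε : ℝ) (f : Fin 3 → ℝ) : Fin 3 → ℝ :=
  ![ε * (f 0 ^ 2 + 2 * f 1 * f 2),
    ε * (f 1 ^ 2 + 2 * f 0 * f 2),
    ε * (f 2 ^ 2 + 2 * f 0 * f 1)]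

/-- `V_ε` maps the closed unit ball `S` of `ℝ³` into itself iff `|ε| ≤ 1/√3`. -/
theorem veps_maps_ball_iff (ε : ℝ) :
    (∀ f : Fin 3 → ℝ, f 0 ^ 2 + f 1 ^ 2 + f 2 ^ 2 ≤ 1 →
        (Veps ε f) 0 ^ 2 + (Veps ε f) 1 ^ 2 + (Veps ε f) 2 ^ 2 ≤ 1)
      ↔ |ε| ≤ 1 / Real.sqrt 3 := by
  have key : ∀ f : Fin 3 → ℝ, (Veps ε f) 0 ^ 2 + (Veps ε f) 1 ^ 2 + (Veps ε f) 2 ^ 2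
      = ε ^ 2 * ((f 0 ^ 2 + f 1 ^ 2 + f 2 ^ 2) ^ 2
        + 2 * (f 0 * f 1 + f 1 * f 2 + f 0 * f 2) ^ 2) := by
    intro f
    simp [Veps]
    ring
  have h3 : (0 : ℝ) < Real.sqrt 3 := Real.sqrt_pos.mpr (by norm_num)
  have hs : Real.sqrt 3 ^ 2 = 3 := Real.sq_sqrt (by norm_num)
  have hq : (1 / Real.sqrt 3) ^ 2 = 1 / 3 := by rw [div_pow, hs]; norm_num
  have hε : |ε| ≤ 1 / Real.sqrt 3 ↔ ε ^ 2 ≤ 1 / 3 := by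
    rw [← hq, sq_le_sq, abs_of_pos (show 0 < 1 / Real.sqrt 3 by positivity)]
  rw [hε]
  constructor
  · intro h
    have h1 := h (fun _ => 1 / Real.sqrt 3) (by simp only [hq]; norm_num)
    rw [key] at h1
    simp only [← sq, hq] at h1
    linarith
  · intro h f hf
    rw [key]
    set a := f 0 ^ 2 + f 1 ^ 2 + f 2 ^ 2 with ha
    set b := f 0 * f 1 + f 1 * f 2 + f 0 * f 2 with hb
    have ha0 : 0 ≤ a := by positivity
    have h1 : b ≤ a := by
      nlinarith [sq_nonneg (f 0 - f 1), sq_nonneg (f 1 - f 2), sq_nonneg (f 0 - f 2)]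
    have h2 : -a ≤ b := by
      nlinarith [sq_nonneg (f 0 + f 1 + f 2)]
    have h4 : b ^ 2 ≤ a ^ 2 := sq_le_sq' h2 h1
    have h5 : a ^ 2 ≤ 1 := by nlinarith
    calc ε ^ 2 * (a ^ 2 + 2 * b ^ 2) ≤ 1 / 3 * 3 := by
          apply mul_le_mul h (by linarith) (by positivity) (by norm_num)
      _ = 1 := by norm_num
end

section
/- If ε ∈ ℝ satisfies 1/3 < |ε| ≤ 1/√3, then the linear map Δ_ε is not positive: there exists a positive semidefinite x ∈ M₂(ℂ) such that Δ_ε(x) is not positive semidefinite. -/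
open Matrix Complex Kronecker ComplexOrder

/-- If `1/3 < |ε| ≤ 1/√3`, then `Δ_ε` is not positive: some positive semidefinite
`x ∈ M₂(ℂ)` has `Δ_ε(x)` not positive semidefinite. -/
theorem deltaEps_not_positive (ε : ℝ) (Δ : M2 →ₗ[ℂ] M4) (hΔ : IsDeltaEps ε Δ)
    (h₁ : 1 / 3 < |ε|) (h₂ : |ε| ≤ 1 / Real.sqrt 3) :
    ∃ x : M2, x.PosSemidef ∧ ¬ (Δ x).PosSemidef := by
  have key : ∀ s : ℝ, (s = 1 ∨ s = -1) → 1 / 3 < s * ε →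
      ∃ x : M2, x.PosSemidef ∧ ¬ (Δ x).PosSemidef := by
    intro s hs h
    refine ⟨(1 : ℂ) • (1 : M2) + ∑ k, (![0, 0, -(s : ℂ)] : Fin 3 → ℂ) k • Pauli k, ?_, ?_⟩
    · have e : (1 : ℂ) • (1 : M2) + ∑ k, (![0, 0, -(s : ℂ)] : Fin 3 → ℂ) k • Pauli k
          = Matrix.diagonal ![1 - (s : ℂ), 1 + (s : ℂ)] := by
        ext i j
        fin_cases i <;> fin_cases j <;> simp [Fin.sum_univ_three, Pauli] <;> ring
      rw [e]
      apply Matrix.PosSemidef.diagonal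
      intro i
      rcases hs with rfl | rfl <;> fin_cases i <;> norm_num
    · rw [hΔ]
      intro hp
      have h0 := hp.re_dotProduct_nonneg
        (fun p : Fin 2 × Fin 2 => (!![1, 0; 0, Complex.I] : M2) p.1 p.2)
      simp [dotProduct, Matrix.mulVec, Fintype.sum_prod_type, K3, Pauli, Matrix.one_apply] at h0
      nlinarith
  rcases abs_cases ε with ⟨h, _⟩ | ⟨h, _⟩
  · exact key 1 (Or.inl rfl) (by linarith)
  · exact key (-1) (Or.inr rfl) (by linarith)
end

section
/- If ε ∈ ℝ satisfies |ε| < 1/√3, then the only fixed point of V_ε in the closed unit ball S is (0,0,0): for every f ∈ S with V_ε(f) = f one has f = (0,0,0). -/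
/-- If `|ε| < 1/√3`, the only fixed point of `V_ε` in the closed unit ball is the
origin. -/
theorem veps_fixed_point_unique (ε : ℝ) (hε : |ε| < 1 / Real.sqrt 3)
    (f : Fin 3 → ℝ) (hf : f 0 ^ 2 + f 1 ^ 2 + f 2 ^ 2 ≤ 1)
    (hfix : Veps ε f = f) : f = 0 := by
  have h0 := congrFun hfix 0
  have h1 := congrFun hfix 1
  have h2 := congrFun hfix 2
  simp [Veps] at h0 h1 h2
  have he : 3 * ε ^ 2 < 1 := by
    have h3 : (0:ℝ) < Real.sqrt 3 := by positivity
    rw [lt_div_iff₀ h3] at hε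
    have hs : Real.sqrt 3 ^ 2 = 3 := Real.sq_sqrt (by norm_num)
    have hp : 0 ≤ |ε| * Real.sqrt 3 := by positivity
    have hlt : (|ε| * Real.sqrt 3) ^ 2 < 1 := by nlinarith
    rw [mul_pow, hs, sq_abs] at hlt
    linarith
  generalize ha : f 0 = a at *
  generalize hb : f 1 = b at *
  generalize hc : f 2 = c at *
  have key : a ^ 2 + b ^ 2 + c ^ 2
      = ε ^ 2 * ((a ^ 2 + b ^ 2 + c ^ 2) ^ 2 + 2 * (a * b + b * c + c * a) ^ 2) := by
    have e : a ^ 2 + b ^ 2 + c ^ 2 = (ε * (a ^ 2 + 2 * b * c)) ^ 2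
        + (ε * (b ^ 2 + 2 * a * c)) ^ 2 + (ε * (c ^ 2 + 2 * a * b)) ^ 2 := by
      rw [h0, h1, h2]
    refine e.trans ?_
    ring
  have hq : (a * b + b * c + c * a) ^ 2 ≤ (a ^ 2 + b ^ 2 + c ^ 2) ^ 2 := by
    apply sq_le_sq'
    · nlinarith [sq_nonneg (a + b + c), sq_nonneg a, sq_nonneg b, sq_nonneg c]
    · nlinarith [sq_nonneg (a - b), sq_nonneg (b - c), sq_nonneg (c - a)]
  have hN : a ^ 2 + b ^ 2 + c ^ 2 ≤ 0 := by
    have hN0 : 0 ≤ a ^ 2 + b ^ 2 + c ^ 2 := by positivity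
    generalize a ^ 2 + b ^ 2 + c ^ 2 = N at *
    have k1 := mul_le_mul_of_nonneg_left hq (sq_nonneg ε)
    have k2 : N ^ 2 ≤ N := by nlinarith
    have k3 := mul_le_mul_of_nonneg_left k2 (sq_nonneg ε)
    nlinarith
  have a0 : a = 0 := by nlinarith [sq_nonneg a, sq_nonneg b, sq_nonneg c]
  have b0 : b = 0 := by nlinarith [sq_nonneg a, sq_nonneg b, sq_nonneg c]
  have c0 : c = 0 := by nlinarith [sq_nonneg a, sq_nonneg b, sq_nonneg c]
  funext i
  fin_cases i
  · exact ha.trans a0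
  · exact hb.trans b0
  · exact hc.trans c0
end

section
/- If ε ∈ ℝ satisfies |ε| = 1/√3, then the fixed points of V_ε in the closed unit ball S are exactly (0,0,0) and (1/(3ε), 1/(3ε), 1/(3ε)): for f ∈ S one has V_ε(f) = f if and only if f = (0,0,0) or f = (1/(3ε), 1/(3ε), 1/(3ε)). -/
/-- If `|ε| = 1/√3`, the fixed points of `V_ε` in the closed unit ball are exactly
`(0,0,0)` and `(1/(3ε), 1/(3ε), 1/(3ε))`. -/
theorem veps_fixed_points (ε : ℝ) (hε : |ε| = 1 / Real.sqrt 3)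
    (f : Fin 3 → ℝ) (hf : f 0 ^ 2 + f 1 ^ 2 + f 2 ^ 2 ≤ 1) :
    Veps ε f = f ↔ f = 0 ∨ f = fun _ => 1 / (3 * ε) := by
  have h3 : ε ^ 2 = 1 / 3 := by
    rw [← sq_abs, hε, div_pow, Real.sq_sqrt (by norm_num)]; norm_num
  have h0 : ε ≠ 0 := by
    rintro rfl
    norm_num at h3
  have key : ∀ x : ℝ, x = 1 / (3 * ε) ↔ x = ε := by
    intro x
    have : 1 / (3 * ε) = ε := by
      field_simp
      linarith
    rw [this]
  constructor
  · intro h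
    have e0 := congrFun h 0
    have e1 := congrFun h 1
    have e2 := congrFun h 2
    simp only [Veps, Matrix.cons_val] at e0 e1 e2
    generalize ha : f 0 = a at *
    generalize hb : f 1 = b at *
    generalize hc : f 2 = c at *
    have hs : (a + b + c) * (ε * (a + b + c) - 1) = 0 := by linear_combination e0 + e1 + e2
    rcases mul_eq_zero.1 hs with hs | hs
    · left
      have hc' : c = -a - b := by linarith
      subst hc'
      have d : (a - b) * (1 - 3 * ε * (a + b)) = 0 := by linear_combination e1 - e0
      have hz : a = 0 ∧ b = 0 := by
        rcases mul_eq_zero.1 d with d | d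
        · have : b = a := by linarith
          subst this
          have : b * (1 + 3 * ε * b) = 0 := by linear_combination -e0
          rcases mul_eq_zero.1 this with t | t
          · exact ⟨t, t⟩
          · exfalso
            have hb' : b = -ε := by linear_combination ε * t - 3 * b * h3
            nlinarith
        · exfalso
          have hb' : b = ε - a := by linear_combination (-ε) * d - 3 * (a + b) * h3
          subst hb'
          have g : (-a - (ε - a)) ^ 2 + 2 * a * (ε - a) = -1 := by
            apply mul_left_cancel₀ h0
            linear_combination e2
          nlinarith
      funext i
      fin_cases i
      · simpa [ha] using hz.1
      · simpa [hb] using hz.2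
      · simp [hc, hz.1, hz.2]
    · right
      have hs' : a + b + c = 3 * ε := by linear_combination 3 * ε * hs - 3 * (a + b + c) * h3
      have q : (a - ε) ^ 2 + (b - ε) ^ 2 + (c - ε) ^ 2 ≤ 0 := by nlinarith
      have pa : a - ε = 0 := by
        apply pow_eq_zero_iff (two_ne_zero) |>.1
        nlinarith [sq_nonneg (a - ε), sq_nonneg (b - ε), sq_nonneg (c - ε)]
      have pb : b - ε = 0 := by
        apply pow_eq_zero_iff (two_ne_zero) |>.1
        nlinarith [sq_nonneg (a - ε), sq_nonneg (b - ε), sq_nonneg (c - ε)]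
      funext i
      rw [key]
      fin_cases i
      · simp [ha]; linarith
      · simp [hb]; linarith
      · simp [hc]; linarith
  · rintro (h | h)
    · subst h
      funext i
      fin_cases i <;> simp [Veps]
    · have hh : ∀ i, f i = ε := fun i => (key _).1 (congrFun h i)
      funext i
      fin_cases i <;> simp [Veps, hh] <;> linear_combination 3 * ε * h3
end

section
/- If ε ∈ ℝ satisfies |ε| < 1/√3, then for every f in the closed unit ball S the iterates of V_ε converge to the origin: V_εⁿ(f) → (0,0,0) as n → ∞. -/
/-- If `|ε| < 1/√3`, then for every `f` in the closed unit ball the iterates of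
`V_ε` converge to the origin. -/
theorem veps_iterates_tendsto_zero (ε : ℝ) (hε : |ε| < 1 / Real.sqrt 3)
    (f : Fin 3 → ℝ) (hf : f 0 ^ 2 + f 1 ^ 2 + f 2 ^ 2 ≤ 1) :
    Filter.Tendsto (fun n => (Veps ε)^[n] f) Filter.atTop (nhds 0) := by
  have h3 : 3 * ε ^ 2 < 1 := by
    have hs : 0 < Real.sqrt 3 := by positivity
    have h1 : |ε| * Real.sqrt 3 < 1 := by rwa [lt_div_iff₀ hs] at hε
    have h2 : (|ε| * Real.sqrt 3) ^ 2 < 1 := by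
      have h0 : 0 ≤ |ε| * Real.sqrt 3 := by positivity
      nlinarith
    rw [mul_pow, sq_abs, Real.sq_sqrt (by norm_num)] at h2
    linarith
  have step : ∀ g : Fin 3 → ℝ,
      (Veps ε g) 0 ^ 2 + (Veps ε g) 1 ^ 2 + (Veps ε g) 2 ^ 2
        ≤ 3 * ε ^ 2 * (g 0 ^ 2 + g 1 ^ 2 + g 2 ^ 2) ^ 2 := by
    intro g
    simp only [Veps, Matrix.cons_val]
    generalize g 0 = x
    generalize g 1 = y
    generalize g 2 = z
    have hP : (x * y + y * z + x * z) ^ 2 ≤ (x ^ 2 + y ^ 2 + z ^ 2) ^ 2 := by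
      apply sq_le_sq'
      · nlinarith [sq_nonneg (x + y + z), sq_nonneg x, sq_nonneg y, sq_nonneg z]
      · nlinarith [sq_nonneg (x - y), sq_nonneg (y - z), sq_nonneg (x - z)]
    have := mul_le_mul_of_nonneg_left hP (sq_nonneg ε)
    nlinarith
  have key : ∀ n : ℕ, ((Veps ε)^[n] f) 0 ^ 2 + ((Veps ε)^[n] f) 1 ^ 2
      + ((Veps ε)^[n] f) 2 ^ 2 ≤ (3 * ε ^ 2) ^ n := by
    intro n
    induction n with
    | zero => simpa using hf
    | succ n ih =>
      rw [Function.iterate_succ_apply']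
      refine (step _).trans ?_
      have hc : 0 ≤ 3 * ε ^ 2 := by positivity
      rw [pow_succ' (3 * ε ^ 2)]
      apply mul_le_mul_of_nonneg_left _ hc
      have h1 : (3 * ε ^ 2) ^ n ≤ 1 := pow_le_one₀ hc h3.le
      have h0 : 0 ≤ ((Veps ε)^[n] f) 0 ^ 2 + ((Veps ε)^[n] f) 1 ^ 2
        + ((Veps ε)^[n] f) 2 ^ 2 := by positivity
      nlinarith
  have hlim : Filter.Tendsto (fun n : ℕ => Real.sqrt ((3 * ε ^ 2) ^ n)) Filter.atTop (nhds 0) := by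
    have := (tendsto_pow_atTop_nhds_zero_of_lt_one (by positivity) h3).sqrt
    simpa using this
  rw [tendsto_pi_nhds]
  intro i
  refine squeeze_zero_norm (fun n => ?_) hlim
  rw [Real.norm_eq_abs]
  apply Real.abs_le_sqrt
  have := key n
  have a0 := sq_nonneg (((Veps ε)^[n] f) 0)
  have a1 := sq_nonneg (((Veps ε)^[n] f) 1)
  have a2 := sq_nonneg (((Veps ε)^[n] f) 2)
  fin_cases i <;> simp only [Fin.zero_eta, Fin.mk_one, Fin.reduceFinMk] <;> linarith
end

section
/- If ε ∈ ℝ satisfies |ε| = 1/√3, then for every f in the closed unit ball S with f ∉ {(1/√3, 1/√3, 1/√3), (−1/√3, −1/√3, −1/√3)}, the iterates of V_ε converge to the origin: V_εⁿ(f) → (0,0,0) as n → ∞. -/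
theorem veps_uv_aux (ε : ℝ) (h : ε ^ 2 = 1 / 3) (f : Fin 3 → ℝ) (n : ℕ) :
    (((Veps ε)^[n] f 0 + (Veps ε)^[n] f 1 + (Veps ε)^[n] f 2) ^ 2 / 3
      = ((f 0 + f 1 + f 2) ^ 2 / 3) ^ (2 ^ n)) ∧
    (((Veps ε)^[n] f 0 ^ 2 + (Veps ε)^[n] f 1 ^ 2 + (Veps ε)^[n] f 2 ^ 2
      - (Veps ε)^[n] f 0 * (Veps ε)^[n] f 1 - (Veps ε)^[n] f 1 * (Veps ε)^[n] f 2
      - (Veps ε)^[n] f 0 * (Veps ε)^[n] f 2) / 3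
      = ((f 0 ^ 2 + f 1 ^ 2 + f 2 ^ 2 - f 0 * f 1 - f 1 * f 2 - f 0 * f 2) / 3) ^ (2 ^ n)) := by
  induction n with
  | zero => simp
  | succ k ih =>
    obtain ⟨h1, h2⟩ := ih
    rw [pow_succ 2 k, pow_mul, pow_mul, ← h1, ← h2, Function.iterate_succ_apply']
    generalize (Veps ε)^[k] f = g
    simp only [Veps, Matrix.cons_val_zero, Matrix.cons_val_one, Matrix.cons_val]
    constructor
    · linear_combination ((g 0 + g 1 + g 2) ^ 4 / 3) * h
    · linear_combination
        ((g 0 ^ 2 + g 1 ^ 2 + g 2 ^ 2 - g 0 * g 1 - g 1 * g 2 - g 0 * g 2) ^ 2 / 3) * h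

/-- If `|ε| = 1/√3`, then for every `f` in the closed unit ball other than
`±(1/√3, 1/√3, 1/√3)` the iterates of `V_ε` converge to the origin. -/
theorem veps_iterates_tendsto_zero_critical (ε : ℝ) (hε : |ε| = 1 / Real.sqrt 3)
    (f : Fin 3 → ℝ) (hf : f 0 ^ 2 + f 1 ^ 2 + f 2 ^ 2 ≤ 1)
    (h₁ : f ≠ fun _ => 1 / Real.sqrt 3) (h₂ : f ≠ fun _ => -(1 / Real.sqrt 3)) :
    Filter.Tendsto (fun n => (Veps ε)^[n] f) Filter.atTop (nhds 0) := by
  have h3 : (1 / Real.sqrt 3) ^ 2 = 1 / 3 := by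
    rw [div_pow, Real.sq_sqrt (by norm_num)]; norm_num
  have h : ε ^ 2 = 1 / 3 := by rw [← sq_abs, hε, h3]
  have key := veps_uv_aux ε h f
  set u := (f 0 + f 1 + f 2) ^ 2 / 3 with hu
  set v := (f 0 ^ 2 + f 1 ^ 2 + f 2 ^ 2 - f 0 * f 1 - f 1 * f 2 - f 0 * f 2) / 3 with hv
  have huv : u + 2 * v ≤ 1 := by rw [hu, hv]; linarith
  have u0 : 0 ≤ u := by positivity
  have v0 : 0 ≤ v := by
    rw [hv]; nlinarith [sq_nonneg (f 0 - f 1), sq_nonneg (f 1 - f 2), sq_nonneg (f 0 - f 2)]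
  have v1 : v < 1 := by linarith
  have u1 : u < 1 := by
    by_contra hc
    have hv0 : v = 0 := by linarith
    have hu1 : u = 1 := by linarith
    have e1 : f 0 = f 1 := by
      have : (f 0 - f 1) ^ 2 = 0 := by
        apply le_antisymm _ (sq_nonneg _)
        nlinarith [sq_nonneg (f 1 - f 2), sq_nonneg (f 0 - f 2)]
      linarith [pow_eq_zero_iff (two_ne_zero) |>.mp this]
    have e2 : f 1 = f 2 := by
      have : (f 1 - f 2) ^ 2 = 0 := by
        apply le_antisymm _ (sq_nonneg _)
        nlinarith [sq_nonneg (f 0 - f 1), sq_nonneg (f 0 - f 2)]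
      linarith [pow_eq_zero_iff (two_ne_zero) |>.mp this]
    have hs : f 0 ^ 2 = (1 / Real.sqrt 3) ^ 2 := by
      rw [h3]
      rw [hu, ← e2, ← e1] at hu1
      linarith
    rcases sq_eq_sq_iff_eq_or_eq_neg.mp hs with h' | h'
    · apply h₁
      funext i
      fin_cases i
      · exact h'
      · exact e1 ▸ h'
      · exact e2 ▸ e1 ▸ h'
    · apply h₂
      funext i
      fin_cases i
      · exact h'
      · exact e1 ▸ h'
      · exact e2 ▸ e1 ▸ h'
  have hpow : Filter.Tendsto (fun n : ℕ => 2 ^ n) Filter.atTop Filter.atTop :=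
    tendsto_pow_atTop_atTop_of_one_lt (by norm_num : 1 < 2)
  have tu := (tendsto_pow_atTop_nhds_zero_of_lt_one u0 u1).comp hpow
  have tv := (tendsto_pow_atTop_nhds_zero_of_lt_one v0 v1).comp hpow
  have tq := tu.add (tv.const_mul 2)
  simp only [mul_zero, add_zero, Function.comp_def] at tq
  have hq : ∀ n, u ^ (2 ^ n) + 2 * v ^ (2 ^ n)
      = (Veps ε)^[n] f 0 ^ 2 + (Veps ε)^[n] f 1 ^ 2 + (Veps ε)^[n] f 2 ^ 2 := by
    intro n
    rw [← (key n).1, ← (key n).2]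
    ring
  rw [tendsto_pi_nhds]
  intro i
  have ts : Filter.Tendsto (fun n => (Veps ε)^[n] f i ^ 2) Filter.atTop (nhds 0) := by
    refine squeeze_zero (fun n => sq_nonneg _) (fun n => ?_) tq
    rw [hq]
    have a0 := sq_nonneg ((Veps ε)^[n] f 0)
    have a1 := sq_nonneg ((Veps ε)^[n] f 1)
    have a2 := sq_nonneg ((Veps ε)^[n] f 2)
    fin_cases i
    · show (Veps ε)^[n] f 0 ^ 2 ≤ _
      linarith
    · show (Veps ε)^[n] f 1 ^ 2 ≤ _
      linarith
    · show (Veps ε)^[n] f 2 ^ 2 ≤ _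
      linarith
  have := ts.sqrt
  simp only [Real.sqrt_sq_eq_abs, Real.sqrt_zero] at this
  exact (tendsto_zero_iff_abs_tendsto_zero _).mpr this
end
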